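/- arXiv:2112.11712 — 2 statements merged into one kernel-verified Lean document; each statement's English description precedes it below -/
import Mathlib

section
/- Let G be a simple graph on n vertices and let A ∈ S(G). Then A has the strong Arnol'd property (SAP) if and only if S^cl(G) + {LᵀA + AL : L an arbitrary n×n real matrix} = Sym_n(ℝ). -/
open Matrix Polynomial

/-- `A` belongs to `S(G)`: symmetric, with off-diagonal nonzero pattern given by `G`. -/
def sMem {n : ℕ} (G : SimpleGraph (Fin n)) (A : Matrix (Fin n) (Fin n) ℝ) : Prop :=
  A.IsSymm ∧ ∀ i j, i ≠ j → (A i j ≠ 0 ↔ G.Adj i j)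

/-- `B` belongs to `S^cl(G)`: symmetric, with off-diagonal zeros on non-edges. -/
def sclMem {n : ℕ} (G : SimpleGraph (Fin n)) (B : Matrix (Fin n) (Fin n) ℝ) : Prop :=
  B.IsSymm ∧ ∀ i j, i ≠ j → ¬ G.Adj i j → B i j = 0

/-- The strong Arnol'd property. -/
def HasSAP {n : ℕ} (A : Matrix (Fin n) (Fin n) ℝ) : Prop :=
  ∀ X : Matrix (Fin n) (Fin n) ℝ, X.IsSymm →
    (∀ i j, A i j * X i j = 0) → (∀ i, X i i = 0) → A * X = 0 → X = 0

/-- The sums `B + LᵀA + AL` with `B ∈ S^cl(G)`, as a subspace of all matrices. -/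
def sclAddTangent {n : ℕ} (G : SimpleGraph (Fin n)) (A : Matrix (Fin n) (Fin n) ℝ) :
    Submodule ℝ (Matrix (Fin n) (Fin n) ℝ) where
  carrier := {M | ∃ B L : Matrix (Fin n) (Fin n) ℝ, sclMem G B ∧ M = B + Lᵀ * A + A * L}
  zero_mem' := ⟨0, 0, ⟨by simp [Matrix.IsSymm], by simp⟩, by simp⟩
  add_mem' := by
    rintro _ _ ⟨B, L, ⟨hB, hB'⟩, rfl⟩ ⟨C, K, ⟨hC, hC'⟩, rfl⟩
    refine ⟨B + C, L + K, ⟨hB.add hC, fun i j h h' => ?_⟩, ?_⟩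
    · simp [hB' i j h h', hC' i j h h']
    · simp only [transpose_add, add_mul, mul_add]
      abel
  smul_mem' := by
    rintro c _ ⟨B, L, ⟨hB, hB'⟩, rfl⟩
    refine ⟨c • B, c • L, ⟨hB.smul c, fun i j h h' => ?_⟩, ?_⟩
    · simp [hB' i j h h']
    · simp [smul_add]

/-- Every linear functional on square matrices is of the form `N ↦ tr(YᵀN)`. -/
lemma dual_apply_eq_trace {n : ℕ} (f : Module.Dual ℝ (Matrix (Fin n) (Fin n) ℝ))
    (N : Matrix (Fin n) (Fin n) ℝ) :
    f N = ((Matrix.of fun i j => f (single i j 1))ᵀ * N).trace := by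
  conv_lhs => rw [matrix_eq_sum_single N]
  simp only [map_sum, trace, diag_apply, mul_apply, transpose_apply, of_apply]
  rw [Finset.sum_comm]
  refine Finset.sum_congr rfl fun i _ => Finset.sum_congr rfl fun j _ => ?_
  rw [← mul_one (N j i), ← smul_eq_mul, ← smul_single, map_smul, smul_eq_mul, smul_eq_mul,
    mul_one, mul_comm]

lemma eq_zero_of_trace_mul_transpose_self {n : ℕ} {X : Matrix (Fin n) (Fin n) ℝ}
    (h : (X * Xᵀ).trace = 0) : X = 0 := by
  rwa [← conjTranspose_eq_transpose_of_trivial, trace_mul_conjTranspose_self_eq_zero_iff] at h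

/-- Symmetric matrices with complementary off-diagonal supports are trace-orthogonal. -/
lemma trace_mul_eq_zero_of_sclMem {n : ℕ} {G : SimpleGraph (Fin n)}
    {A B X : Matrix (Fin n) (Fin n) ℝ} (hA : sMem G A) (hB : sclMem G B) (hX : X.IsSymm)
    (hAX : ∀ i j, A i j * X i j = 0) (hd : ∀ i, X i i = 0) : (B * X).trace = 0 := by
  simp only [trace, diag_apply, mul_apply]
  refine Finset.sum_eq_zero fun i _ => Finset.sum_eq_zero fun j _ => ?_
  rw [hX.apply i j]
  by_cases hij : i = j
  · subst hij
    simp [hd]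
  by_cases hG : G.Adj i j
  · simp [(mul_eq_zero.mp (hAX i j)).resolve_left ((hA.2 i j hij).mpr hG)]
  · simp [hB.2 i j hij hG]

/-- Under the SAP, a functional vanishing on `S^cl(G) + {LᵀA + AL}` vanishes on all symmetric
matrices. -/
lemma dual_eq_zero_of_hasSAP {n : ℕ} {G : SimpleGraph (Fin n)}
    {A M : Matrix (Fin n) (Fin n) ℝ} (hA : sMem G A) (hS : HasSAP A)
    (f : Module.Dual ℝ (Matrix (Fin n) (Fin n) ℝ))
    (hf : ∀ N ∈ sclAddTangent G A, f N = 0) (hM : M.IsSymm) : f M = 0 := by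
  set Y : Matrix (Fin n) (Fin n) ℝ := Matrix.of fun i j => f (single i j 1) with hY
  have hfY : ∀ N, f N = (Yᵀ * N).trace := dual_apply_eq_trace f
  have hX : (Y + Yᵀ).IsSymm := isSymm_add_transpose_self Y
  have hscl : ∀ B, sclMem G B → f B = 0 := fun B hB => hf B ⟨B, 0, hB, by simp⟩
  have hzero : ∀ i j, i = j ∨ G.Adj i j → (Y + Yᵀ) i j = 0 := by
    intro i j hij
    have h := hscl (single i j 1 + single j i 1) ⟨by
      simp [Matrix.IsSymm, add_comm], fun k l hkl hG => by
        have h₁ : ¬ (i = k ∧ j = l) := by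
          rintro ⟨rfl, rfl⟩
          exact hij.elim hkl hG
        have h₂ : ¬ (j = k ∧ i = l) := by
          rintro ⟨rfl, rfl⟩
          exact hij.elim (fun h => hkl h.symm) (fun h => hG h.symm)
        simp [h₁, h₂]⟩
    simpa [hY] using h
  have hXA : (Y + Yᵀ) * A = 0 := by
    apply eq_zero_of_trace_mul_transpose_self
    set L := ((Y + Yᵀ) * A)ᵀ
    have h := hf (Lᵀ * A + A * L) ⟨0, L, ⟨by simp [Matrix.IsSymm], by simp⟩, by simp⟩
    have h₁ : (Yᵀ * (Lᵀ * A)).trace = (Y * A * L).trace := by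
      rw [← trace_transpose]
      simp only [transpose_mul, transpose_transpose, hA.1.eq]
      rw [trace_mul_comm, Matrix.mul_assoc]
    rw [hfY, mul_add, trace_add, h₁] at h
    rw [add_mul, add_mul, trace_add, Matrix.mul_assoc Yᵀ]
    exact h
  have hX0 : Y + Yᵀ = 0 := by
    refine hS _ hX (fun i j => ?_) (fun i => hzero i i (.inl rfl)) ?_
    · by_cases h : i = j ∨ G.Adj i j
      · rw [hzero i j h, mul_zero]
      · rw [not_or] at h
        rw [not_not.mp (mt (hA.2 i j h.1).mp h.2), zero_mul]
    · simpa [transpose_mul, hA.1.eq, hX.eq, add_comm] using congrArg transpose hXA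
  have hsymm : (Yᵀ * M).trace = (Y * M).trace := by
    rw [← trace_transpose, transpose_mul, transpose_transpose, hM.eq, trace_mul_comm]
  have hsum : (Y * M).trace + (Yᵀ * M).trace = 0 := by
    rw [← trace_add, ← add_mul, hX0, zero_mul, trace_zero]
  rw [hfY]
  linarith

/-- Proposition 1(c): `A ∈ S(G)` has the SAP iff
`S^cl(G) + {LᵀA + AL : L arbitrary} = Sym_n(ℝ)`. -/
theorem sap_iff_sum_eq_sym (n : ℕ) (G : SimpleGraph (Fin n))
    (A : Matrix (Fin n) (Fin n) ℝ) (hA : sMem G A) :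
    HasSAP A ↔
      ∀ M : Matrix (Fin n) (Fin n) ℝ, M.IsSymm →
        ∃ B L : Matrix (Fin n) (Fin n) ℝ,
          sclMem G B ∧ M = B + Lᵀ * A + A * L := by
  constructor
  · intro hS M hM
    by_contra hMW
    obtain ⟨f, hfM, hf⟩ :=
      Submodule.exists_le_ker_of_notMem (p := sclAddTangent G A) (v := M) hMW
    exact hfM (dual_eq_zero_of_hasSAP hA hS f (fun N hN => hf hN) hM)
  · intro h X hX hAX hd hAX0
    obtain ⟨B, L, hB, hXBL⟩ := h X hX
    have hXA0 : X * A = 0 := by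
      simpa [transpose_mul, hA.1.eq, hX.eq] using congrArg transpose hAX0
    apply eq_zero_of_trace_mul_transpose_self
    rw [hX.eq]
    nth_rewrite 1 [hXBL]
    rw [add_mul, add_mul, trace_add, trace_add, trace_mul_eq_zero_of_sclMem hA hB hX hAX hd,
      Matrix.mul_assoc, hAX0, trace_mul_comm (A * L), ← Matrix.mul_assoc, hXA0]
    simp
end

section
/- Let G be a simple graph on n vertices and let A ∈ S(G) have the strong Arnol'd property (SAP). Then there is ε > 0 such that for every n×n real symmetric matrix M with ‖M − A‖ < ε, there exists a matrix A' ∈ S(G) such that A' has the SAP and pin(A') = pin(M). -/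
open Matrix Polynomial

/-- The partial inertia of a real symmetric matrix: the number of positive
and negative eigenvalues, counted with multiplicity. -/
noncomputable def pin {n : ℕ} (A : Matrix (Fin n) (Fin n) ℝ) : ℕ × ℕ :=
  ((A.charpoly.roots.filter (fun x => 0 < x)).card,
   (A.charpoly.roots.filter (fun x => x < 0)).card)

/-- The Frobenius norm of a real matrix. -/
noncomputable def frobNorm {n : ℕ} (A : Matrix (Fin n) (Fin n) ℝ) : ℝ :=
  Real.sqrt (∑ i, ∑ j, (A i j) ^ 2)

theorem equivalent_toQuadraticForm'_congruence {n : ℕ} (B : Matrix (Fin n) (Fin n) ℝ)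
    {P : Matrix (Fin n) (Fin n) ℝ} (hP : IsUnit P) :
    QuadraticMap.Equivalent (Pᵀ * B * P).toQuadraticForm' B.toQuadraticForm' :=
  ⟨⟨Matrix.toLinearEquiv' P hP.invertible, fun x => by
    simp [Matrix.toQuadraticForm', Matrix.toLinearMap₂'_apply', ← Matrix.mulVec_mulVec,
      Matrix.dotProduct_mulVec, Matrix.vecMul_transpose]⟩⟩

theorem toQuadraticForm'_diagonal {n : ℕ} (d : Fin n → ℝ) :
    (diagonal d).toQuadraticForm' = QuadraticMap.weightedSumSquares ℝ d := by
  ext x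
  simp [Matrix.toQuadraticForm', Matrix.toLinearMap₂'_apply', Matrix.mulVec_diagonal,
    dotProduct, mul_left_comm]

theorem pin_eq_sigPos_sigNeg {n : ℕ} {A : Matrix (Fin n) (Fin n) ℝ} (hA : A.IsHermitian) :
    pin A = (sigPos A.toQuadraticForm', sigNeg A.toQuadraticForm') := by
  have hD : (hA.eigenvectorUnitary : Matrix (Fin n) (Fin n) ℝ)ᵀ * A * hA.eigenvectorUnitary =
      diagonal hA.eigenvalues := by
    simpa [Unitary.conjStarAlgAut_star_apply, star_eq_conjTranspose] using
      hA.conjStarAlgAut_star_eigenvectorUnitary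
  have e : QuadraticMap.Equivalent A.toQuadraticForm'
      (QuadraticMap.weightedSumSquares ℝ hA.eigenvalues) := by
    rw [← toQuadraticForm'_diagonal, ← hD]
    exact (equivalent_toQuadraticForm'_congruence A
      (Unitary.toUnits hA.eigenvectorUnitary).isUnit).symm
  rw [QuadraticForm.sigPos_of_equiv_weightedSumSquares e,
    QuadraticForm.sigNeg_of_equiv_weightedSumSquares e, pin, hA.roots_charpoly_eq_eigenvalues,
    Multiset.filter_map, Multiset.filter_map, Multiset.card_map, Multiset.card_map,
    Set.ncard_eq_toFinset_card', Set.ncard_eq_toFinset_card']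
  simp [Finset.card_def]

/-- **Sylvester's law of inertia**: the partial inertia is invariant under congruence. -/
theorem pin_congruence {n : ℕ} {B P : Matrix (Fin n) (Fin n) ℝ} (hB : B.IsSymm) (hP : IsUnit P) :
    pin (Pᵀ * B * P) = pin B := by
  have h : (Pᵀ * B * P).IsSymm := by
    simp [Matrix.IsSymm, Matrix.transpose_mul, hB.eq, Matrix.mul_assoc]
  have e := equivalent_toQuadraticForm'_congruence B hP
  rw [pin_eq_sigPos_sigNeg (isHermitian_iff_isSymm.mpr h),
    pin_eq_sigPos_sigNeg (isHermitian_iff_isSymm.mpr hB), e.sigPos_eq, e.sigNeg_eq]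

open scoped Matrix.Norms.Frobenius Topology

/-- Square real matrices of size `n`. -/
abbrev SqMat (n : ℕ) := Matrix (Fin n) (Fin n) ℝ

theorem frobNorm_eq_norm {n : ℕ} (A : SqMat n) : frobNorm A = ‖A‖ := by
  simp [frobNorm, frobenius_norm_def, Real.sqrt_eq_rpow]

/-- Symmetrization of a matrix, restricted to the diagonal and the edges of `G`. -/
noncomputable def patternMap {n : ℕ} (G : SimpleGraph (Fin n)) :
    SqMat n →ₗ[ℝ] SqMat n where
  toFun P := Matrix.of fun i j => open Classical in if i = j ∨ G.Adj i j then P i j + P j i else 0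
  map_add' P Q := by ext i j; by_cases h : i = j ∨ G.Adj i j <;> simp [h]; ring
  map_smul' c P := by ext i j; by_cases h : i = j ∨ G.Adj i j <;> simp [h]; ring

theorem patternMap_isSymm {n : ℕ} (G : SimpleGraph (Fin n)) (P : SqMat n) :
    (patternMap G P).IsSymm := by
  ext i j
  simp only [patternMap, LinearMap.coe_mk, AddHom.coe_mk, Matrix.transpose_apply, Matrix.of_apply]
  have := G.adj_comm i j
  grind

theorem patternMap_apply_eq_zero {n : ℕ} {G : SimpleGraph (Fin n)} {i j : Fin n} (hij : i ≠ j)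
    (h : ¬G.Adj i j) (P : SqMat n) : patternMap G P i j = 0 := by
  simp [patternMap, hij, h]

/-- The SAP says that `S(G)` meets the congruence orbit of `A` transversally. -/
theorem exists_patternMap_add_congruence {n : ℕ} {G : SimpleGraph (Fin n)}
    {A : SqMat n} (hA : sMem G A) (hsap : HasSAP A) (Z : SqMat n) :
    ∃ P L N : SqMat n, patternMap G P + (Lᵀ * A + A * L) + (N - Nᵀ) = Z := by
  let t : SqMat n →ₗ[ℝ] SqMat n := (Matrix.transposeLinearEquiv (Fin n) (Fin n) ℝ ℝ).toLinearMap
  let D : SqMat n × SqMat n × SqMat n →ₗ[ℝ] SqMat n := (patternMap G).coprod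
    ((LinearMap.mulRight ℝ A ∘ₗ t + LinearMap.mulLeft ℝ A).coprod (LinearMap.id - t))
  suffices h : LinearMap.range D = ⊤ by
    obtain ⟨⟨P, L, N⟩, h⟩ := LinearMap.range_eq_top.mp h Z
    exact ⟨P, L, N, by rw [← h]; simp [D, t, add_assoc]⟩
  by_contra h
  obtain ⟨f, hf0, hf⟩ := Submodule.exists_le_ker_of_lt_top _ (lt_top_iff_ne_top.mpr h)
  have key (P L N : SqMat n) :
      f (patternMap G P + ((Lᵀ * A + A * L) + (N - Nᵀ))) = 0 :=
    hf ⟨(P, L, N), by simp [D, t]⟩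
  let Y : SqMat n := Matrix.of fun i j => f (Matrix.single i j 1)
  have hfY (Z : SqMat n) : f Z = ∑ i, ∑ j, Z i j * Y i j := by
    conv_lhs => rw [Matrix.matrix_eq_sum_single Z]
    simp only [map_sum]
    refine Finset.sum_congr rfl fun i _ => Finset.sum_congr rfl fun j _ => ?_
    change f _ = Z i j • f (Matrix.single i j 1)
    rw [← map_smul, Matrix.smul_single, smul_eq_mul, mul_one]
  have hYs : Y.IsSymm := by
    ext i j
    have := key 0 0 (Matrix.single i j 1)
    simp [sub_eq_zero] at this
    simp [Y, this]
  have hYp (i j : Fin n) (hij : i = j ∨ G.Adj i j) : Y i j = 0 := by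
    have h1 := key (Matrix.single i j 1) 0 0
    have h2 : patternMap G (Matrix.single i j 1) =
        (Matrix.single i j 1 + Matrix.single j i 1 : SqMat n) := by
      ext a b
      simp only [patternMap, LinearMap.coe_mk, AddHom.coe_mk, Matrix.of_apply, Matrix.add_apply,
        Matrix.single_apply]
      have := G.adj_comm i j
      grind
    have h3 := hYs.apply i j
    simp [h2] at h1
    simp [Y] at h3 ⊢
    linarith
  have hAY : A * Y = 0 := by
    have hfT (Z : SqMat n) : f Zᵀ = f Z := by
      rw [hfY, hfY, Finset.sum_comm]
      simp [hYs.apply]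
    ext k l
    have h1 := key 0 (Matrix.single k l 1) 0
    rw [← hA.1.eq, ← Matrix.transpose_mul, hA.1.eq] at h1
    simp only [map_zero, map_add, hfT, transpose_zero, sub_zero, zero_add, add_zero] at h1
    have h2 : f (A * Matrix.single k l 1) = (A * Y) k l := by
      rw [hfY, Matrix.mul_apply, Finset.sum_comm]
      simp [Matrix.mul_apply, Matrix.single_apply, ite_and, hA.1.apply]
    rw [← h2, Matrix.zero_apply]
    linarith
  have hY : Y = 0 := hsap Y hYs (fun i j => by
    by_cases hij : i = j ∨ G.Adj i j
    · simp [hYp i j hij]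
    · push Not at hij
      simp [not_not.mp (mt (hA.2 i j hij.1).mp hij.2)]) (fun i => hYp i i (.inl rfl)) hAY
  exact hf0 (LinearMap.ext fun Z => by simp [hfY, hY])

theorem eventually_hasSAP {n : ℕ} {G : SimpleGraph (Fin n)} {A : SqMat n}
    (hA : sMem G A) (hsap : HasSAP A) : ∀ᶠ B in 𝓝 A, sMem G B → HasSAP B := by
  let K : Submodule ℝ (SqMat n) :=
    { carrier := {Y | Y.IsSymm ∧ ∀ i j, i = j ∨ G.Adj i j → Y i j = 0}
      add_mem' := fun hY hZ => ⟨hY.1.add hZ.1, fun i j h => by simp [hY.2 i j h, hZ.2 i j h]⟩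
      zero_mem' := ⟨Matrix.isSymm_zero, fun _ _ _ => rfl⟩
      smul_mem' := fun c Y hY => ⟨hY.1.smul c, fun i j h => by simp [hY.2 i j h]⟩ }
  let φ (B : SqMat n) : K →L[ℝ] SqMat n := ContinuousLinearMap.mul ℝ (SqMat n) B ∘L K.subtypeL
  have hφ : Continuous φ := by fun_prop
  have hinj : Function.Injective (φ A) := by
    refine (injective_iff_map_eq_zero _).mpr fun Y hY => Subtype.ext ?_
    refine hsap Y Y.2.1 (fun i j => ?_) (fun i => Y.2.2 i i (.inl rfl)) hY
    by_cases hij : i = j ∨ G.Adj i j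
    · simp [Y.2.2 i j hij]
    · push Not at hij
      simp [not_not.mp (mt (hA.2 i j hij.1).mp hij.2)]
  filter_upwards [hφ.continuousAt.eventually (ContinuousLinearMap.isOpen_injective.mem_nhds hinj)]
    with B hB hBG Y hYs hYp hYd hBY
  have hYK : Y ∈ K := by
    refine ⟨hYs, fun i j hij => ?_⟩
    by_cases h : i = j
    · exact h ▸ hYd i
    · exact (mul_eq_zero.mp (hYp i j)).resolve_left ((hBG.2 i j h).mpr (hij.resolve_left h))
  exact congrArg Subtype.val (@hB ⟨Y, hYK⟩ 0 (hBY.trans (Matrix.mul_zero B).symm))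

theorem eventually_sMem {n : ℕ} {G : SimpleGraph (Fin n)} {A : SqMat n}
    (hA : sMem G A) : ∀ᶠ P in 𝓝 (0 : SqMat n), sMem G (A + patternMap G P) := by
  have h : ∀ᶠ P in 𝓝 (0 : SqMat n), ∀ i j, G.Adj i j →
      (A + patternMap G P) i j ≠ 0 := by
    simp only [Filter.eventually_all]
    intro i j hij
    have hc : Continuous fun P : SqMat n => (A + patternMap G P) i j :=
      (continuous_const.add (patternMap G).continuous_of_finiteDimensional).matrix_elem i j
    exact hc.continuousAt.eventually_ne (by simpa using (hA.2 i j hij.ne).mpr hij)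
  filter_upwards [h] with P hP
  refine ⟨hA.1.add (patternMap_isSymm G P), fun i j hij => ⟨fun h => ?_, hP i j⟩⟩
  by_contra hG
  refine h ?_
  simp [patternMap_apply_eq_zero hij hG, not_not.mp (mt (hA.2 i j hij).mp hG)]

/-- Bifurcation lemma for the SAP: nearby partial inertias of symmetric matrices
are realizable in `S(G)` with the SAP. -/
theorem bifurcation_sap (n : ℕ) (G : SimpleGraph (Fin n))
    (A : Matrix (Fin n) (Fin n) ℝ) (hA : sMem G A) (hsap : HasSAP A) :
    ∃ ε > 0, ∀ M : Matrix (Fin n) (Fin n) ℝ, M.IsSymm → frobNorm (M - A) < ε →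
      ∃ A' : Matrix (Fin n) (Fin n) ℝ,
        sMem G A' ∧ HasSAP A' ∧ pin A' = pin M := by
  let H : SqMat n →L[ℝ] SqMat n := (patternMap G).toContinuousLinearMap
  let T : SqMat n →L[ℝ] SqMat n :=
    (Matrix.transposeLinearEquiv (Fin n) (Fin n) ℝ ℝ).toLinearMap.toContinuousLinearMap
  let p₁ : SqMat n × SqMat n × SqMat n →L[ℝ] SqMat n := .fst ℝ (SqMat n) (SqMat n × SqMat n)
  let p₂ : SqMat n × SqMat n × SqMat n →L[ℝ] SqMat n :=
    .fst ℝ (SqMat n) (SqMat n) ∘L .snd ℝ (SqMat n) (SqMat n × SqMat n)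
  let p₃ : SqMat n × SqMat n × SqMat n →L[ℝ] SqMat n :=
    .snd ℝ (SqMat n) (SqMat n) ∘L .snd ℝ (SqMat n) (SqMat n × SqMat n)
  let g : SqMat n × SqMat n × SqMat n → SqMat n :=
    (fun x => 1 + (T ∘L p₂) x) * (fun x => A + (H ∘L p₁) x) * (fun x => 1 + p₂ x) + (p₃ - T ∘L p₃)
  have hg (x : SqMat n × SqMat n × SqMat n) :
      g x = (1 + x.2.1)ᵀ * (A + patternMap G x.1) * (1 + x.2.1) + (x.2.2 - x.2.2ᵀ) := by
    simp [g, T, H, p₁, p₂, p₃]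
  have hd := ((((T ∘L p₂).hasStrictFDerivAt (x := 0)).const_add (1 : SqMat n)).mul'
    (((H ∘L p₁).hasStrictFDerivAt (x := 0)).const_add A)).mul'
    ((p₂.hasStrictFDerivAt (x := 0)).const_add (1 : SqMat n)) |>.add
    ((p₃ - T ∘L p₃).hasStrictFDerivAt (x := 0))
  have hmap := HasStrictFDerivAt.map_nhds_eq_of_surj hd (LinearMap.range_eq_top.mpr fun Z => by
    obtain ⟨P, L, N, h⟩ := exists_patternMap_add_congruence hA hsap Z
    refine ⟨(P, L, N), ?_⟩
    change (1 + (0 : SqMat n)ᵀ) * (A + patternMap G 0) * L +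
      ((1 + (0 : SqMat n)ᵀ) * patternMap G P + Lᵀ * (A + patternMap G 0)) * (1 + 0) +
      (N - Nᵀ) = Z
    rw [← h]
    simp [add_assoc, add_comm (A * L)])
  change Filter.map g (𝓝 0) = 𝓝 (g 0) at hmap
  rw [hg 0] at hmap
  have h1 : ∀ᶠ x : SqMat n × SqMat n × SqMat n in 𝓝 0, sMem G (A + patternMap G x.1) :=
    continuous_fst.tendsto' (0 : SqMat n × SqMat n × SqMat n) 0 rfl
      |>.eventually (eventually_sMem hA)
  have h2 : ∀ᶠ x : SqMat n × SqMat n × SqMat n in 𝓝 0,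
      sMem G (A + patternMap G x.1) → HasSAP (A + patternMap G x.1) := by
    have hc : Continuous fun x : SqMat n × SqMat n × SqMat n => A + patternMap G x.1 :=
      continuous_const.add (H.continuous.comp continuous_fst)
    exact hc.tendsto' 0 A (by simp) |>.eventually (eventually_hasSAP hA hsap)
  have h3 : ∀ᶠ x : SqMat n × SqMat n × SqMat n in 𝓝 0, IsUnit (1 + x.2.1) := by
    have hc : Continuous fun x : SqMat n × SqMat n × SqMat n => 1 + x.2.1 := by fun_prop
    exact hc.tendsto' 0 1 (by simp) |>.eventually (Units.isOpen.mem_nhds isUnit_one)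
  have h4 := Filter.image_mem_map (m := g) (h1.and (h2.and h3))
  simp only [hmap, Prod.fst_zero, Prod.snd_zero, map_zero, add_zero, transpose_one, one_mul,
    mul_one, transpose_zero, sub_zero] at h4
  obtain ⟨ε, hε, hball⟩ := Metric.mem_nhds_iff.mp h4
  refine ⟨ε, hε, fun M hM hMA => ?_⟩
  rw [frobNorm_eq_norm, ← dist_eq_norm] at hMA
  obtain ⟨x, ⟨hx1, hx2, hx3⟩, hx⟩ := hball hMA
  refine ⟨A + patternMap G x.1, hx1, hx2 hx1, ?_⟩
  rw [← pin_congruence hx1.1 hx3]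
  congr 1
  simp only [hg] at hx
  have hs : ((1 + x.2.1)ᵀ * (A + patternMap G x.1) * (1 + x.2.1)).IsSymm := by
    simp only [Matrix.IsSymm, transpose_mul, transpose_transpose, hx1.1.eq, Matrix.mul_assoc]
  have ht := congrArg transpose hx
  rw [transpose_add, hs.eq, hM.eq, transpose_sub, transpose_transpose] at ht
  ext i j
  have e1 := congrFun₂ hx i j
  have e2 := congrFun₂ ht i j
  simp only [Matrix.add_apply, Matrix.sub_apply, Matrix.transpose_apply] at e1 e2
  linarith
end
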